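/- Let f ∈ L¹(ℝ^d), and let (μ_n) be a sequence of positive Borel measures on ℝ^d that is uniformly translation-bounded, i.e. there is a constant C such that μ_n(B₁ + x) ≤ C for every n and every x ∈ ℝ^d, where B₁ is the open unit ball. Suppose that (f ∗ μ_n)(x) = 1 for Lebesgue-a.e. x, for every n, and that μ_n converges vaguely to a measure μ, i.e. ∫ φ dμ_n → ∫ φ dμ for every continuous compactly supported function φ on ℝ^d. Then (f ∗ μ)(x) = 1 for Lebesgue-a.e. x. -/

import Mathlib

open MeasureTheory Set Filter
open scoped ENNReal NNReal

noncomputable section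

section

variable {E : Type*} [NormedAddCommGroup E]

/-- A compactly supported continuous function stays so, after a translation. -/
lemma hasCompactSupport_comp_const_add {φ : E → ℝ} (hφ : HasCompactSupport φ) (y : E) :
    HasCompactSupport fun t => φ (y + t) :=
  hφ.comp_homeomorph (Homeomorph.addLeft y)

variable [MeasurableSpace E]

lemma isLocallyFiniteMeasure_of_forall_ball_le {ν : Measure E} {C : ℝ≥0}
    (hν : ∀ x, ν (Metric.ball x 1) ≤ C) : IsLocallyFiniteMeasure ν :=
  ⟨fun x => ⟨Metric.ball x 1, Metric.ball_mem_nhds x one_pos,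
    (hν x).trans_lt ENNReal.coe_lt_top⟩⟩

/-- The integrals of all translates of a continuous compactly supported function are bounded,
uniformly over the measures with a given translation bound. -/
lemma exists_forall_integral_norm_translate_le {φ : E → ℝ} (hc : Continuous φ)
    (hs : HasCompactSupport φ) (C : ℝ≥0) :
    ∃ M : ℝ, ∀ ν : Measure E, (∀ x, ν (Metric.ball x 1) ≤ C) →
      ∀ y, ∫ t, ‖φ (y + t)‖ ∂ν ≤ M := by
  obtain ⟨B, hB⟩ := hc.bounded_above_of_compact_support hs
  have hB0 : 0 ≤ B := (norm_nonneg _).trans (hB 0)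
  obtain ⟨s, -, hsfin, hcov⟩ := hs.isCompact.finite_cover_balls one_pos
  lift s to Finset E using hsfin
  refine ⟨B * (s.card * C), fun ν hν y => ?_⟩
  have hmeas : ν ((fun t => y + t) ⁻¹' tsupport φ) ≤ (s.card * C : ℝ≥0) := by
    calc ν ((fun t => y + t) ⁻¹' tsupport φ)
        ≤ ν (⋃ x ∈ s, Metric.ball (x - y) 1) := by
          refine measure_mono fun t ht => ?_
          obtain ⟨x, hx, hxt⟩ := mem_iUnion₂.1 (hcov ht)
          refine mem_iUnion₂.2 ⟨x, hx, ?_⟩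
          rw [mem_ball_iff_norm] at hxt ⊢
          rwa [show t - (x - y) = y + t - x by abel]
      _ ≤ ∑ x ∈ s, ν (Metric.ball (x - y) 1) := measure_biUnion_finset_le _ _
      _ ≤ ∑ _x ∈ s, (C : ℝ≥0∞) := Finset.sum_le_sum fun x _ => hν _
      _ = (s.card * C : ℝ≥0) := by simp
  have hreal : ν.real ((fun t => y + t) ⁻¹' tsupport φ) ≤ s.card * C := by
    simpa [Measure.real] using ENNReal.toReal_mono ENNReal.coe_ne_top hmeas
  have hzero : ∀ t, t ∉ (fun t => y + t) ⁻¹' tsupport φ → ‖φ (y + t)‖ = 0 := fun t ht => by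
    rw [image_eq_zero_of_notMem_tsupport ht, norm_zero]
  rw [← setIntegral_eq_integral_of_forall_compl_eq_zero hzero]
  calc ∫ t in (fun t => y + t) ⁻¹' tsupport φ, ‖φ (y + t)‖ ∂ν
      ≤ ‖∫ t in (fun t => y + t) ⁻¹' tsupport φ, ‖φ (y + t)‖ ∂ν‖ := Real.le_norm_self _
    _ ≤ B * ν.real ((fun t => y + t) ⁻¹' tsupport φ) :=
        norm_setIntegral_le_of_norm_le_const (hmeas.trans_lt ENNReal.coe_lt_top)
          fun t _ => by simpa using hB (y + t)
    _ ≤ B * (s.card * C) := by gcongr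

variable [BorelSpace E]

lemma isFiniteMeasureOnCompacts_of_integrable [LocallyCompactSpace E] {μ : Measure E}
    (h : ∀ φ : E → ℝ, Continuous φ → HasCompactSupport φ → Integrable φ μ) :
    IsFiniteMeasureOnCompacts μ := by
  refine ⟨fun K hK => ?_⟩
  obtain ⟨φ, hφK, -, hφs, hφ⟩ := exists_continuous_one_zero_of_isCompact hK isClosed_empty
    (disjoint_empty K)
  refine lt_of_le_of_lt ?_ (h φ φ.continuous hφs).lintegral_lt_top
  rw [← setLIntegral_one]
  refine le_trans (setLIntegral_mono' hK.measurableSet fun x hx => ?_)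
    (setLIntegral_le_lintegral K _)
  simp [hφK hx]

/-- If the integrals of continuous compactly supported functions against locally finite measures
converge to their integrals against a measure for which some such function is not integrable, then
they converge to zero. -/
lemma tendsto_integral_zero_of_not_integrable {μn : ℕ → Measure E} {μ : Measure E}
    [∀ n, IsLocallyFiniteMeasure (μn n)]
    (hvague : ∀ φ : E → ℝ, Continuous φ → HasCompactSupport φ →
      Tendsto (fun n => ∫ x, φ x ∂(μn n)) atTop (nhds (∫ x, φ x ∂μ)))
    {ψ : E → ℝ} (hψc : Continuous ψ) (hψs : HasCompactSupport ψ) (hψ : ¬ Integrable ψ μ)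
    {φ : E → ℝ} (hφc : Continuous φ) (hφs : HasCompactSupport φ) :
    Tendsto (fun n => ∫ x, φ x ∂(μn n)) atTop (nhds 0) := by
  have hc : Continuous fun x => ‖φ x‖ + ‖ψ x‖ := hφc.norm.add hψc.norm
  have hs : HasCompactSupport fun x => ‖φ x‖ + ‖ψ x‖ := hφs.norm.add hψs.norm
  have hni : ¬ Integrable (fun x => ‖φ x‖ + ‖ψ x‖) μ := fun h =>
    hψ (h.mono' (hψc.aestronglyMeasurable)
      (.of_forall fun x => by simp))
  have hlim := hvague _ hc hs
  rw [integral_undef hni] at hlim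
  refine squeeze_zero_norm (fun n => ?_) hlim
  exact (norm_integral_le_integral_norm _).trans <|
    integral_mono (hφc.integrable_of_hasCompactSupport hφs).norm
      (hc.integrable_of_hasCompactSupport hs) fun x => by simp

variable [SecondCountableTopology E] {lam : Measure E}

lemma integrable_mul_translate_prod {f : E → ℝ} (hf : Integrable f lam) {ν : Measure E}
    [IsFiniteMeasureOnCompacts ν] [SFinite ν]
    {φ : E → ℝ} (hc : Continuous φ) (hs : HasCompactSupport φ) {M : ℝ}
    (hM : ∀ y, ∫ t, ‖φ (y + t)‖ ∂ν ≤ M) :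
    Integrable (fun p : E × E => f p.1 * φ (p.1 + p.2)) (lam.prod ν) := by
  have hmeas : AEStronglyMeasurable (fun p : E × E => f p.1 * φ (p.1 + p.2)) (lam.prod ν) :=
    hf.aestronglyMeasurable.comp_fst.mul
      (hc.comp (continuous_fst.add continuous_snd)).aestronglyMeasurable
  refine (integrable_prod_iff hmeas).2 ⟨.of_forall fun y => ?_, ?_⟩
  · have hcy : Continuous fun t => φ (y + t) := by fun_prop
    exact (hcy.integrable_of_hasCompactSupport (μ := ν)
      (hasCompactSupport_comp_const_add hs y)).const_mul (f y)
  · refine (hf.norm.mul_const M).mono' hmeas.norm.integral_prod_right' (.of_forall fun y => ?_)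
    rw [Real.norm_of_nonneg (integral_nonneg fun _ => norm_nonneg _)]
    simp only [norm_mul, integral_const_mul]
    exact mul_le_mul_of_nonneg_left (hM y) (norm_nonneg _)

variable [SFinite lam] [lam.IsAddRightInvariant]

lemma integrable_mul_sub_prod {f : E → ℝ} (hf : Integrable f lam) {ν : Measure E}
    [IsFiniteMeasureOnCompacts ν] [SFinite ν]
    {φ : E → ℝ} (hc : Continuous φ) (hs : HasCompactSupport φ) {M : ℝ}
    (hM : ∀ y, ∫ t, ‖φ (y + t)‖ ∂ν ≤ M) :
    Integrable (fun p : E × E => φ p.1 * f (p.1 - p.2)) (lam.prod ν) := by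
  refine ((measurePreserving_sub_prod lam ν).integrable_comp_of_integrable
    (integrable_mul_translate_prod hf hc hs hM)).congr (.of_forall fun p => ?_)
  simp [mul_comm]

lemma integrable_mul_integral_sub {f : E → ℝ} (hf : Integrable f lam) {ν : Measure E}
    [IsFiniteMeasureOnCompacts ν] [SFinite ν]
    {φ : E → ℝ} (hc : Continuous φ) (hs : HasCompactSupport φ) {M : ℝ}
    (hM : ∀ y, ∫ t, ‖φ (y + t)‖ ∂ν ≤ M) :
    Integrable (fun x => φ x * ∫ t, f (x - t) ∂ν) lam := by
  simpa only [integral_const_mul] using (integrable_mul_sub_prod hf hc hs hM).integral_prod_left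

/-- Testing the convolution of `f` and `ν` against `φ` amounts to testing `f` against the
correlation of `φ` and `ν`. -/
lemma integral_mul_integral_sub {f : E → ℝ} (hf : Integrable f lam) {ν : Measure E}
    [IsFiniteMeasureOnCompacts ν] [SFinite ν]
    {φ : E → ℝ} (hc : Continuous φ) (hs : HasCompactSupport φ) {M : ℝ}
    (hM : ∀ y, ∫ t, ‖φ (y + t)‖ ∂ν ≤ M) :
    ∫ x, φ x * ∫ t, f (x - t) ∂ν ∂lam = ∫ y, f y * ∫ t, φ (y + t) ∂ν ∂lam := by
  have hG := integrable_mul_translate_prod hf hc hs hM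
  have hmp := measurePreserving_sub_prod lam ν
  calc ∫ x, φ x * ∫ t, f (x - t) ∂ν ∂lam
      = ∫ p : E × E, φ p.1 * f (p.1 - p.2) ∂(lam.prod ν) := by
        rw [integral_prod _ (integrable_mul_sub_prod hf hc hs hM)]
        simp only [integral_const_mul]
    _ = ∫ p : E × E, f (p.1 - p.2) * φ (p.1 - p.2 + p.2) ∂(lam.prod ν) := by
        simp [mul_comm]
    _ = ∫ p : E × E, f p.1 * φ (p.1 + p.2) ∂(lam.prod ν) := by
        conv_rhs => rw [← hmp.map_eq]
        rw [integral_map hmp.measurable.aemeasurable]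
        rw [hmp.map_eq]
        exact hG.aestronglyMeasurable
    _ = ∫ y, f y * ∫ t, φ (y + t) ∂ν ∂lam := by
        rw [integral_prod _ hG]
        simp only [integral_const_mul]

end

/-- Vague limits preserve `f ∗ μ = 1` when the limit measure is finite on compact sets. -/
lemma conv_eq_one_of_vague_limit_of_isFiniteMeasureOnCompacts {E : Type*}
    [NormedAddCommGroup E] [NormedSpace ℝ E] [FiniteDimensional ℝ E] [MeasurableSpace E]
    [BorelSpace E] {lam : Measure E} [lam.IsAddHaarMeasure] {f : E → ℝ} (hf : Integrable f lam)
    {μn : ℕ → Measure E} {μ : Measure E} [IsFiniteMeasureOnCompacts μ]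
    {C : ℝ≥0} (hC : ∀ n x, μn n (Metric.ball x 1) ≤ C)
    (hconv : ∀ n, ∀ᵐ x ∂lam, (∫ t, f (x - t) ∂(μn n)) = 1)
    (hvague : ∀ φ : E → ℝ, Continuous φ → HasCompactSupport φ →
      Tendsto (fun n => ∫ x, φ x ∂(μn n)) atTop (nhds (∫ x, φ x ∂μ))) :
    ∀ᵐ x ∂lam, (∫ t, f (x - t) ∂μ) = 1 := by
  have : ProperSpace E := FiniteDimensional.proper ℝ E
  have (n : ℕ) : IsLocallyFiniteMeasure (μn n) := isLocallyFiniteMeasure_of_forall_ball_le (hC n)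
  have htranslate {φ : E → ℝ} (hc : Continuous φ) (hs : HasCompactSupport φ) (y : E) :
      Tendsto (fun n => ∫ t, φ (y + t) ∂(μn n)) atTop (nhds (∫ t, φ (y + t) ∂μ)) :=
    hvague _ (hc.comp (continuous_const.add continuous_id)) (hasCompactSupport_comp_const_add hs y)
  have hbound {φ : E → ℝ} (hc : Continuous φ) (hs : HasCompactSupport φ) :
      ∃ M : ℝ, (∀ n y, ∫ t, ‖φ (y + t)‖ ∂(μn n) ≤ M) ∧ ∀ y, ∫ t, ‖φ (y + t)‖ ∂μ ≤ M := by
    obtain ⟨M, hM⟩ := exists_forall_integral_norm_translate_le hc hs C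
    exact ⟨M, fun n => hM _ (hC n), fun y =>
      le_of_tendsto (htranslate hc.norm hs.norm y) (.of_forall fun n => hM _ (hC n) y)⟩
  refine ae_eq_of_integral_contDiff_smul_eq ?_ (locallyIntegrable_const 1) fun φ hφ hs => ?_
  · refine locallyIntegrable_iff.2 fun K hK => ?_
    obtain ⟨φ, hφK, -, hs, -⟩ := exists_continuous_one_zero_of_isCompact hK isClosed_empty
      (disjoint_empty K)
    obtain ⟨M, -, hM⟩ := hbound φ.continuous hs
    refine (integrable_mul_integral_sub hf φ.continuous hs hM).integrableOn.congr_fun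
      (fun x hx => ?_) hK.measurableSet
    simp [hφK hx]
  · have hc := hφ.continuous
    obtain ⟨M, hMn, hM⟩ := hbound hc hs
    simp only [smul_eq_mul]
    rw [integral_mul_integral_sub hf hc hs hM]
    refine tendsto_nhds_unique (f := fun n => ∫ y, f y * ∫ t, φ (y + t) ∂(μn n) ∂lam)
      (l := atTop) ?_ ?_
    · refine tendsto_integral_of_dominated_convergence (fun y => ‖f y‖ * M) (fun n => ?_)
        (hf.norm.mul_const M) (fun n => .of_forall fun y => ?_)
        (.of_forall fun y => (htranslate hc hs y).const_mul _)
      · simpa only [integral_const_mul] using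
          (integrable_mul_translate_prod hf hc hs (hMn n)).integral_prod_left.aestronglyMeasurable
      · rw [norm_mul]
        exact mul_le_mul_of_nonneg_left
          ((norm_integral_le_integral_norm _).trans (hMn n y)) (norm_nonneg _)
    · refine tendsto_const_nhds.congr fun n => ?_
      rw [← integral_mul_integral_sub hf hc hs (hMn n)]
      refine integral_congr_ae ?_
      filter_upwards [hconv n] with x hx
      rw [hx]

/-- If `f ∈ L¹(ℝ^d)`, `(μ_n)` is a uniformly translation-bounded sequence of positive measures
with `f ∗ μ_n = 1` a.e. for every `n`, and `μ_n → μ` vaguely, then `f ∗ μ = 1` a.e. -/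
theorem conv_eq_one_of_vague_limit
    (d : ℕ) (f : EuclideanSpace ℝ (Fin d) → ℝ)
    (hf : Integrable f (volume : Measure (EuclideanSpace ℝ (Fin d))))
    (μn : ℕ → Measure (EuclideanSpace ℝ (Fin d)))
    (μ : Measure (EuclideanSpace ℝ (Fin d)))
    (C : ℝ≥0) (hC : ∀ n (x : EuclideanSpace ℝ (Fin d)), μn n (Metric.ball x 1) ≤ C)
    (hconv : ∀ n, ∀ᵐ x ∂(volume : Measure (EuclideanSpace ℝ (Fin d))),
      (∫ t, f (x - t) ∂(μn n)) = 1)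
    (hvague : ∀ φ : EuclideanSpace ℝ (Fin d) → ℝ, Continuous φ → HasCompactSupport φ →
      Tendsto (fun n => ∫ x, φ x ∂(μn n)) atTop (nhds (∫ x, φ x ∂μ))) :
    ∀ᵐ x ∂(volume : Measure (EuclideanSpace ℝ (Fin d))), (∫ t, f (x - t) ∂μ) = 1 := by
  by_cases h : ∀ φ : EuclideanSpace ℝ (Fin d) → ℝ, Continuous φ → HasCompactSupport φ →
      Integrable φ μ
  · have := isFiniteMeasureOnCompacts_of_integrable h
    exact conv_eq_one_of_vague_limit_of_isFiniteMeasureOnCompacts hf hC hconv hvague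
  · -- Then the `μn n` converge vaguely to the zero measure, which is absurd.
    push Not at h
    obtain ⟨ψ, hψc, hψs, hψ⟩ := h
    have (n : ℕ) : IsLocallyFiniteMeasure (μn n) :=
      isLocallyFiniteMeasure_of_forall_ball_le (hC n)
    have hzero := conv_eq_one_of_vague_limit_of_isFiniteMeasureOnCompacts (μ := 0) hf hC hconv
      fun φ hφc hφs => by
        simpa using tendsto_integral_zero_of_not_integrable hvague hψc hψs hψ hφc hφs
    filter_upwards [hzero] with x hx
    simp at hx
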